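/- arXiv:1103.4166 — 14 statements merged into one kernel-verified Lean document; each statement's English description precedes it below -/
import Mathlib

section
/- Let L be a Lie algebra over a commutative ring R and let A ⊆ L. Define B₀ = A and, inductively, B_{k+1} = { ⁅a, b⁆ : a ∈ A, b ∈ B_k }. Then the Lie subalgebra of L generated by A (the smallest Lie subalgebra containing A) coincides, as an R-submodule of L, with the R-linear span of ⋃_{k≥0} B_k. -/
/-- A submodule stable under bracketing by each element of `A` is stable under bracketing by each
element of the Lie subalgebra generated by `A`. -/
theorem Submodule.lie_mem_of_mem_lieSpan
    {R L M : Type*} [CommRing R] [LieRing L] [LieAlgebra R L]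
    [AddCommGroup M] [Module R M] [LieRingModule L M] [LieModule R L M]
    {A : Set L} {S : Submodule R M} (hS : ∀ a ∈ A, ∀ y ∈ S, ⁅a, y⁆ ∈ S)
    {x : L} (hx : x ∈ LieSubalgebra.lieSpan R L A) {y : M} (hy : y ∈ S) : ⁅x, y⁆ ∈ S := by
  induction hx using LieSubalgebra.lieSpan_induction generalizing y with
  | mem a ha => exact hS a ha y hy
  | zero => simp
  | add u v _ _ hu hv => rw [add_lie]; exact S.add_mem (hu hy) (hv hy)
  | smul r u _ hu => rw [smul_lie]; exact S.smul_mem r (hu hy)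
  | lie u v _ _ hu hv => rw [lie_lie]; exact S.sub_mem (hu (hv hy)) (hv (hu hy))

/-- A submodule which contains `A`, is contained in the Lie subalgebra generated by `A`, and is
stable under bracketing by each element of `A` is equal to that Lie subalgebra. -/
theorem LieSubalgebra.lieSpan_toSubmodule_eq_of_lie_mem
    {R L : Type*} [CommRing R] [LieRing L] [LieAlgebra R L] {A : Set L} {S : Submodule R L}
    (hA : A ⊆ S) (hS : S ≤ (LieSubalgebra.lieSpan R L A).toSubmodule)
    (hlie : ∀ a ∈ A, ∀ y ∈ S, ⁅a, y⁆ ∈ S) :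
    (LieSubalgebra.lieSpan R L A).toSubmodule = S := by
  let K : LieSubalgebra R L :=
    { S with lie_mem' := fun hx hy => Submodule.lie_mem_of_mem_lieSpan hlie (hS hx) hy }
  have hK : LieSubalgebra.lieSpan R L A ≤ K := LieSubalgebra.lieSpan_le.2 hA
  exact le_antisymm hK hS

/-- The Lie subalgebra of `L` generated by a subset `A` coincides, as an `R`-submodule,
with the `R`-linear span of the iterated left-nested brackets
`B₀ = A`, `B_{k+1} = {⁅a, b⁆ : a ∈ A, b ∈ B_k}`. -/
theorem lieSpan_toSubmodule_eq_span_iUnion_brackets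
    {R L : Type*} [CommRing R] [LieRing L] [LieAlgebra R L]
    (A : Set L) (B : ℕ → Set L)
    (hB0 : B 0 = A)
    (hBsucc : ∀ k : ℕ, B (k + 1) = {x : L | ∃ a ∈ A, ∃ y ∈ B k, x = ⁅a, y⁆}) :
    (LieSubalgebra.lieSpan R L A).toSubmodule = Submodule.span R (⋃ k : ℕ, B k) := by
  refine LieSubalgebra.lieSpan_toSubmodule_eq_of_lie_mem ?_ ?_ ?_
  · rw [← hB0]
    exact (Set.subset_iUnion B 0).trans Submodule.subset_span
  · refine Submodule.span_le.2 (Set.iUnion_subset fun k => ?_)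
    induction k with
    | zero => rw [hB0]; exact LieSubalgebra.subset_lieSpan
    | succ k ih =>
      rw [hBsucc]
      rintro _ ⟨a, ha, y, hy, rfl⟩
      exact LieSubalgebra.lie_mem _ (LieSubalgebra.subset_lieSpan ha) (ih hy)
  · intro a ha y hy
    induction hy using Submodule.span_induction with
    | mem y hy =>
      obtain ⟨k, hk⟩ := Set.mem_iUnion.1 hy
      refine Submodule.subset_span (Set.mem_iUnion.2 ⟨k + 1, ?_⟩)
      rw [hBsucc]
      exact ⟨a, ha, y, hk, rfl⟩
    | zero => simp
    | add u v _ _ hu hv => rw [lie_add]; exact Submodule.add_mem _ hu hv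
    | smul r u _ hu => rw [lie_smul]; exact Submodule.smul_mem _ r hu
end

section
/- Let X₁, …, X_r : ℝⁿ → ℝⁿ be vector fields that are linearly independent over ℝ, i.e. linearly independent as elements of the real vector space of all maps ℝⁿ → ℝⁿ. Then there exist an integer m with 1 ≤ m ≤ r and points x₍₁₎, …, x₍ₘ₎ ∈ ℝⁿ such that the r vectors v_α = (X_α(x₍₁₎), …, X_α(x₍ₘ₎)) ∈ (ℝⁿ)^m, α = 1, …, r — the values at (x₍₁₎,…,x₍ₘ₎) of the diagonal prolongations of X₁, …, X_r to (ℝⁿ)^m — are linearly independent in (ℝⁿ)^m. -/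
/-- If a nonempty family of subspaces of a finite-dimensional space has trivial intersection, then
some `k` members of it meet in a subspace of codimension at least `min k (finrank K V)`. -/
lemma Submodule.exists_finrank_iInf_le_sub {K V ι : Type*} [DivisionRing K] [AddCommGroup V]
    [Module K V] [FiniteDimensional K V] [Nonempty ι] (S : ι → Submodule K V)
    (hS : ⨅ x, S x = ⊥) (k : ℕ) :
    ∃ p : Fin k → ι, Module.finrank K (⨅ i, S (p i) : Submodule K V) ≤ Module.finrank K V - k := by
  induction k with
  | zero => exact ⟨Fin.elim0, Submodule.finrank_le _⟩
  | succ k ih =>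
    obtain ⟨p, hp⟩ := ih
    have hcons (x : ι) : ⨅ i, S ((Fin.cons x p : Fin (k + 1) → ι) i) = S x ⊓ ⨅ i, S (p i) := by
      ext v
      simp [Fin.forall_fin_succ]
    by_cases hle : ∀ x, ⨅ i, S (p i) ≤ S x
    · have hbot : ⨅ i, S (p i) = ⊥ := le_bot_iff.mp (hS ▸ le_iInf hle)
      refine ⟨Fin.cons (Classical.arbitrary ι) p, ?_⟩
      rw [hcons, hbot, inf_bot_eq, finrank_bot]
      exact Nat.zero_le _
    · obtain ⟨x, hx⟩ := not_forall.mp hle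
      refine ⟨Fin.cons x p, ?_⟩
      rw [hcons]
      have := Submodule.finrank_lt_finrank_of_lt (inf_lt_right.mpr hx)
      omega

/-- If `X₁, …, X_r : ℝⁿ → ℝⁿ` are vector fields that are linearly independent over `ℝ`
(as elements of the real vector space of all maps `ℝⁿ → ℝⁿ`), then there exist
`1 ≤ m ≤ r` and points `x₍₁₎, …, x₍ₘ₎ ∈ ℝⁿ` at which the diagonal prolongations of the
`X_α` to `(ℝⁿ)^m` take linearly independent values, i.e. the vectors
`v_α = (X_α(x₍₁₎), …, X_α(x₍ₘ₎)) ∈ (ℝⁿ)^m` are linearly independent. -/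
theorem exists_points_diagProl_linearIndependent {n r : ℕ} (hr : 0 < r)
    (Xa : Fin r → (Fin n → ℝ) → (Fin n → ℝ))
    (h : LinearIndependent ℝ Xa) :
    ∃ m : ℕ, 1 ≤ m ∧ m ≤ r ∧ ∃ pts : Fin m → (Fin n → ℝ),
      LinearIndependent ℝ (fun α : Fin r => (fun i => Xa α (pts i) : Fin m → (Fin n → ℝ))) := by
  have mem_ker (x : Fin n → ℝ) (c : Fin r → ℝ) :
      c ∈ LinearMap.ker (LinearMap.proj x ∘ₗ Fintype.linearCombination ℝ Xa) ↔
        ∑ α, c α • Xa α x = 0 := by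
    simp [Fintype.linearCombination_apply]
  obtain ⟨p, hp⟩ := Submodule.exists_finrank_iInf_le_sub
    (fun x => LinearMap.ker (LinearMap.proj x ∘ₗ Fintype.linearCombination ℝ Xa)) (by
      refine (Submodule.eq_bot_iff _).mpr fun c hc => ?_
      simp only [Submodule.mem_iInf, mem_ker] at hc
      refine funext (Fintype.linearIndependent_iff.mp h c (funext fun x => ?_))
      simpa using hc x) r
  rw [Module.finrank_fin_fun, Nat.sub_self, Nat.le_zero, Submodule.finrank_eq_zero] at hp
  refine ⟨r, hr, le_rfl, p, Fintype.linearIndependent_iff.mpr fun c hc => congrFun ?_⟩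
  refine (Submodule.eq_bot_iff _).mp hp c ?_
  simp only [Submodule.mem_iInf, mem_ker]
  intro i
  simpa using congrFun hc i
end

section
/- (Superposition rule for Riccati equations) Let b₁, b₂, b₃ : ℝ → ℝ and let x₀, x₁, x₂, x₃ : ℝ → ℝ be differentiable solutions of the Riccati equation ẋ(t) = b₁(t) + b₂(t)x(t) + b₃(t)x(t)² such that x₀(t) ≠ x₂(t) and x₁(t) ≠ x₃(t) for all t. Then the cross-ratio t ↦ ((x₀(t) − x₁(t))(x₃(t) − x₂(t))) / ((x₀(t) − x₂(t))(x₃(t) − x₁(t))) is a constant function of t. -/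
/-- **Superposition rule for Riccati equations**: the cross-ratio of four solutions of a
Riccati equation is constant in time. -/
theorem riccati_cross_ratio_constant
    (b₁ b₂ b₃ x₀ x₁ x₂ x₃ : ℝ → ℝ)
    (h₀ : ∀ t, HasDerivAt x₀ (b₁ t + b₂ t * x₀ t + b₃ t * x₀ t ^ 2) t)
    (h₁ : ∀ t, HasDerivAt x₁ (b₁ t + b₂ t * x₁ t + b₃ t * x₁ t ^ 2) t)
    (h₂ : ∀ t, HasDerivAt x₂ (b₁ t + b₂ t * x₂ t + b₃ t * x₂ t ^ 2) t)
    (h₃ : ∀ t, HasDerivAt x₃ (b₁ t + b₂ t * x₃ t + b₃ t * x₃ t ^ 2) t)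
    (h02 : ∀ t, x₀ t ≠ x₂ t) (h13 : ∀ t, x₁ t ≠ x₃ t) :
    ∃ c : ℝ, ∀ t : ℝ,
      ((x₀ t - x₁ t) * (x₃ t - x₂ t)) / ((x₀ t - x₂ t) * (x₃ t - x₁ t)) = c := by
  have hden (t : ℝ) : (x₀ t - x₂ t) * (x₃ t - x₁ t) ≠ 0 :=
    mul_ne_zero (sub_ne_zero.mpr (h02 t)) (sub_ne_zero.mpr (h13 t).symm)
  have hderiv (t : ℝ) : HasDerivAt
      (fun t => ((x₀ t - x₁ t) * (x₃ t - x₂ t)) / ((x₀ t - x₂ t) * (x₃ t - x₁ t))) 0 t := by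
    refine ((((h₀ t).fun_sub (h₁ t)).fun_mul ((h₃ t).fun_sub (h₂ t))).fun_div
      (((h₀ t).fun_sub (h₂ t)).fun_mul ((h₃ t).fun_sub (h₁ t))) (hden t)).congr_deriv ?_
    refine div_eq_zero_iff.mpr (Or.inl ?_)
    ring
  exact ⟨_, fun t => is_const_of_deriv_eq_zero (fun s => (hderiv s).differentiableAt)
    (fun s => (hderiv s).deriv) t 0⟩
end

section
/- Let b₁, b₂, b₃ : ℝ → ℝ be differentiable with b₁(t)b₃(t) ≠ 0 for all t, let c₁, c₂, c₃ ∈ ℝ with c₁c₃ ≠ 0, and let D : ℝ → ℝ be differentiable and nowhere vanishing. Then there exists a differentiable G : ℝ → ℝ with G(t) > 0 for all t transforming the Riccati equation ẋ = b₁(t) + b₂(t)x + b₃(t)x² into ẋ̃ = D(t)(c₁ + c₂x̃ + c₃x̃²) via x̃ = G(t)x — i.e., satisfying for all t the identities G·b₁ = D·c₁, b₂ + G'/G = D·c₂, and b₃ = G·D·c₃ — if and only if for all t: D(t)²c₁c₃ = b₁(t)b₃(t), D(t)b₁(t)c₁ > 0, and (b₂(t) + (1/2)(b₃'(t)/b₃(t)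 − b₁'(t)/b₁(t)))·√(c₁c₃/(b₁(t)b₃(t))) = sgn(D(t))·c₂. Moreover, in that case the transformation is uniquely defined by G(t) = √(b₃(t)c₁/(b₁(t)c₃)). -/
/-- If `D² k = b₁ b₃`, then the logarithmic derivative of `D c₁ / b₁` is half the difference of
the logarithmic derivatives of `b₃` and `b₁`. -/
lemma logDeriv_mul_const_div_of_sq_mul_eq {b₁ b₃ D : ℝ → ℝ} {c k : ℝ}
    (hb₁ : Differentiable ℝ b₁) (hb₃ : Differentiable ℝ b₃) (hD : Differentiable ℝ D)
    (hb : ∀ t, b₁ t * b₃ t ≠ 0) (hc : c ≠ 0) (hD0 : ∀ t, D t ≠ 0)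
    (h : ∀ t, D t ^ 2 * k = b₁ t * b₃ t) (t : ℝ) :
    deriv (fun s => D s * c / b₁ s) t / (D t * c / b₁ t) =
      (1 / 2) * (deriv b₃ t / b₃ t - deriv b₁ t / b₁ t) := by
  have h₁ : b₁ t ≠ 0 := left_ne_zero_of_mul (hb t)
  have h₃ : b₃ t ≠ 0 := right_ne_zero_of_mul (hb t)
  have hDt := hD0 t
  have hG := ((hD t).hasDerivAt.mul_const c).fun_div (hb₁ t).hasDerivAt h₁
  have hsq := ((hD t).hasDerivAt.fun_pow 2).mul_const k
  have hmul := (hb₁ t).hasDerivAt.fun_mul (hb₃ t).hasDerivAt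
  rw [← funext h] at hmul
  have key := hsq.unique hmul
  have hk := h t
  have hdiff : 2 * deriv D t * (b₁ t * b₃ t) =
      D t * (deriv b₁ t * b₃ t + b₁ t * deriv b₃ t) := by
    rw [← key, ← hk]
    norm_num
    ring
  rw [hG.deriv]
  field_simp
  linear_combination hdiff

/-- If `D² k = p` with `D ≠ 0` and `p ≠ 0`, then `√(k / p) = |D|⁻¹`. -/
lemma sqrt_div_eq_inv_abs {D k p : ℝ} (hp : p ≠ 0) (h : D ^ 2 * k = p) :
    Real.sqrt (k / p) = |D|⁻¹ := by
  have hD : D ≠ 0 := by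
    rintro rfl
    simp [eq_comm, hp] at h
  have hkp : k / p = (D⁻¹) ^ 2 := by
    field_simp
    linear_combination h
  rw [hkp, Real.sqrt_sq_eq_abs, abs_inv]

lemma mul_inv_abs_eq_sign_mul_iff {D x c : ℝ} (hD : D ≠ 0) :
    x * |D|⁻¹ = Real.sign D * c ↔ x = D * c := by
  rw [← div_eq_mul_inv, div_eq_iff (abs_ne_zero.mpr hD)]
  have hs : Real.sign D * c * |D| = D * c := by
    rcases hD.lt_or_gt with h | h
    · rw [Real.sign_of_neg h, abs_of_neg h]; ring
    · rw [Real.sign_of_pos h, abs_of_pos h]; ring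
  rw [hs]


/-- Necessary and sufficient conditions for the existence of a positive time-dependent
linear change of variables `x̃ = G(t)x` transforming the Riccati equation with coefficients
`(b₁, b₂, b₃)` into `ẋ̃ = D(t)(c₁ + c₂x̃ + c₃x̃²)`, together with the uniqueness of the
transformation `G(t) = √(b₃(t)c₁/(b₁(t)c₃))`. -/
theorem riccati_reduction_iff
    (b₁ b₂ b₃ D : ℝ → ℝ) (c₁ c₂ c₃ : ℝ)
    (hb₁ : Differentiable ℝ b₁) (hb₂ : Differentiable ℝ b₂) (hb₃ : Differentiable ℝ b₃)
    (hb : ∀ t, b₁ t * b₃ t ≠ 0) (hc : c₁ * c₃ ≠ 0)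
    (hD : Differentiable ℝ D) (hD0 : ∀ t, D t ≠ 0) :
    ((∃ G : ℝ → ℝ, Differentiable ℝ G ∧ (∀ t, 0 < G t) ∧
        ∀ t, G t * b₁ t = D t * c₁ ∧ b₂ t + deriv G t / G t = D t * c₂ ∧
          b₃ t = G t * D t * c₃) ↔
      (∀ t, D t ^ 2 * (c₁ * c₃) = b₁ t * b₃ t ∧ 0 < D t * b₁ t * c₁ ∧
        (b₂ t + (1 / 2) * (deriv b₃ t / b₃ t - deriv b₁ t / b₁ t)) *
            Real.sqrt (c₁ * c₃ / (b₁ t * b₃ t)) = Real.sign (D t) * c₂)) ∧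
    (∀ G : ℝ → ℝ, Differentiable ℝ G → (∀ t, 0 < G t) →
      (∀ t, G t * b₁ t = D t * c₁ ∧ b₂ t + deriv G t / G t = D t * c₂ ∧
        b₃ t = G t * D t * c₃) →
      ∀ t, G t = Real.sqrt (b₃ t * c₁ / (b₁ t * c₃))) := by
  have h₁ : ∀ t, b₁ t ≠ 0 := fun t => left_ne_zero_of_mul (hb t)
  have hc₁ : c₁ ≠ 0 := left_ne_zero_of_mul hc
  have hc₃ : c₃ ≠ 0 := right_ne_zero_of_mul hc
  refine ⟨⟨?_, fun h => ?_⟩, ?_⟩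
  · rintro ⟨G, -, hpos, hG⟩
    have hsq : ∀ t, D t ^ 2 * (c₁ * c₃) = b₁ t * b₃ t := fun t => by
      obtain ⟨e₁, -, e₃⟩ := hG t
      linear_combination (-(D t * c₃)) * e₁ - b₁ t * e₃
    have hGeq : G = fun s => D s * c₁ / b₁ s :=
      funext fun t => (eq_div_iff (h₁ t)).mpr (hG t).1
    intro t
    obtain ⟨e₁, e₂, -⟩ := hG t
    refine ⟨hsq t, ?_, ?_⟩
    · have e : D t * b₁ t * c₁ = G t * b₁ t ^ 2 := by linear_combination (-b₁ t) * e₁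
      rw [e]
      exact mul_pos (hpos t) (by have := h₁ t; positivity)
    · rw [sqrt_div_eq_inv_abs (hb t) (hsq t), mul_inv_abs_eq_sign_mul_iff (hD0 t),
        ← logDeriv_mul_const_div_of_sq_mul_eq hb₁ hb₃ hD hb hc₁ hD0 hsq t, ← e₂, hGeq]
  · have hsq := fun t => (h t).1
    refine ⟨fun s => D s * c₁ / b₁ s, (hD.mul_const c₁).fun_div hb₁ h₁, fun t => ?_,
      fun t => ⟨div_mul_cancel₀ _ (h₁ t), ?_, ?_⟩⟩
    · have e : D t * c₁ / b₁ t = D t * b₁ t * c₁ / b₁ t ^ 2 := by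
        have := h₁ t
        field_simp
      exact (div_pos (h t).2.1 (by have := h₁ t; positivity)).trans_eq e.symm
    · have e := (h t).2.2
      rw [sqrt_div_eq_inv_abs (hb t) (hsq t), mul_inv_abs_eq_sign_mul_iff (hD0 t)] at e
      rw [logDeriv_mul_const_div_of_sq_mul_eq hb₁ hb₃ hD hb hc₁ hD0 hsq t, e]
    · have := h₁ t
      field_simp
      linear_combination -hsq t
  · intro G _ hpos hG t
    obtain ⟨e₁, -, e₃⟩ := hG t
    have e : b₃ t * c₁ / (b₁ t * c₃) = G t ^ 2 := by
      rw [div_eq_iff (mul_ne_zero (h₁ t) hc₃)]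
      linear_combination c₁ * e₃ - G t * c₃ * e₁
    rw [e, Real.sqrt_sq (hpos t).le]
end

section
/- Let b₁, b₂, b₃ : ℝ → ℝ be differentiable with b₁(t)b₃(t) ≠ 0 for all t. There exist constants c₁, c₂, c₃ ∈ ℝ with c₁c₃ ≠ 0, a differentiable nowhere-vanishing function D : ℝ → ℝ, and a differentiable function G : ℝ → ℝ with G(t) > 0 satisfying for all t the identities G·b₁ = D·c₁, b₂ + G'/G = D·c₂, and b₃ = G·D·c₃ (i.e., the change of variables x̃ = G(t)x transforms ẋ = b₁ + b₂x + b₃x² into ẋ̃ = D(t)(c₁ + c₂x̃ + c₃x̃²)) if and only if there exists a real constant K such that b₂(t) + (1/2)(b₃'(t)/b₃(t) − b₁'(t)/b₁(t)) = K·√|b₁(t)b₃(t)| for all t. -/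
/-- A continuous nowhere-vanishing real function has constant sign. -/
theorem exists_sign_of_continuous_ne_zero {f : ℝ → ℝ} (hf : Continuous f) (h0 : ∀ t, f t ≠ 0) :
    ∃ s : ℝ, s * s = 1 ∧ ∀ t, 0 < s * f t := by
  have key : ∀ u v, f u < 0 → 0 < f v → False := fun u v hu hv => by
    obtain ⟨t, ht⟩ := mem_range_of_exists_le_of_exists_ge hf ⟨u, hu.le⟩ ⟨v, hv.le⟩
    exact h0 t ht
  rcases lt_or_gt_of_ne (h0 0) with h | h
  · refine ⟨-1, by norm_num, fun t => ?_⟩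
    rcases lt_or_gt_of_ne (h0 t) with ht | ht
    · linarith
    · exact (key 0 t h ht).elim
  · refine ⟨1, by norm_num, fun t => ?_⟩
    rcases lt_or_gt_of_ne (h0 t) with ht | ht
    · exact (key t 0 ht h).elim
    · linarith

/-- The logarithmic derivative of `G` when `G²` is a constant multiple of `g / f`. -/
theorem deriv_div_self_of_sq_mul_eq {f g G : ℝ → ℝ} {a c t : ℝ} (hf : DifferentiableAt ℝ f t)
    (hg : DifferentiableAt ℝ g t) (hG : DifferentiableAt ℝ G t) (hf0 : f t ≠ 0) (hg0 : g t ≠ 0)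
    (hG0 : G t ≠ 0) (hc : c ≠ 0) (h : ∀ u, G u ^ 2 * f u * c = a * g u) :
    deriv G t / G t = (1 / 2) * (deriv g t / g t - deriv f t / f t) := by
  have h1 := (((hG.hasDerivAt.pow 2).mul hf.hasDerivAt).mul_const c)
  have h2 := hg.hasDerivAt.const_mul a
  have h3 := h1.unique (h2.congr_of_eventuallyEq (.of_forall h))
  simp only [Pi.pow_apply, Nat.cast_ofNat, Nat.add_one_sub_one, pow_one] at h3
  have h4 := h t
  have h5 : G t * c * ((2 * deriv G t * f t + G t * deriv f t) * g t - G t * f t * deriv g t)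
      = 0 := by
    linear_combination g t * h3 - deriv g t * h4
  have h6 := (mul_eq_zero.mp h5).resolve_left (mul_ne_zero hG0 hc)
  field_simp
  linear_combination h6


/-- A Riccati equation with `b₁b₃ ≠ 0` can be transformed by some positive time-dependent
linear change of variables `x̃ = G(t)x` into an equation `ẋ̃ = D(t)(c₁ + c₂x̃ + c₃x̃²)` with
constants `c₁c₃ ≠ 0` and nonvanishing `D` if and only if
`b₂ + (1/2)(b₃'/b₃ − b₁'/b₁) = K·√|b₁b₃|` for some real constant `K`. -/
theorem riccati_integrability_condition
    (b₁ b₂ b₃ : ℝ → ℝ)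
    (hb₁ : Differentiable ℝ b₁) (hb₂ : Differentiable ℝ b₂) (hb₃ : Differentiable ℝ b₃)
    (hb : ∀ t, b₁ t * b₃ t ≠ 0) :
    (∃ (c₁ c₂ c₃ : ℝ) (D G : ℝ → ℝ), c₁ * c₃ ≠ 0 ∧
        Differentiable ℝ D ∧ (∀ t, D t ≠ 0) ∧
        Differentiable ℝ G ∧ (∀ t, 0 < G t) ∧
        ∀ t, G t * b₁ t = D t * c₁ ∧ b₂ t + deriv G t / G t = D t * c₂ ∧
          b₃ t = G t * D t * c₃) ↔
      (∃ K : ℝ, ∀ t, b₂ t + (1 / 2) * (deriv b₃ t / b₃ t - deriv b₁ t / b₁ t)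
          = K * Real.sqrt |b₁ t * b₃ t|) := by
  have hb₁0 : ∀ t, b₁ t ≠ 0 := fun t => left_ne_zero_of_mul (hb t)
  have hb₃0 : ∀ t, b₃ t ≠ 0 := fun t => right_ne_zero_of_mul (hb t)
  constructor
  · rintro ⟨c₁, c₂, c₃, D, G, hc, hD, hD0, hG, hGpos, h⟩
    obtain ⟨s, hs, hsD⟩ := exists_sign_of_continuous_ne_zero hD.continuous hD0
    have hr : √|c₁ * c₃| ≠ 0 := (Real.sqrt_pos.mpr (abs_pos.mpr hc)).ne'
    refine ⟨s * c₂ / √|c₁ * c₃|, fun t => ?_⟩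
    have hlog := deriv_div_self_of_sq_mul_eq (a := c₁) (hb₁ t) (hb₃ t) (hG t) (hb₁0 t) (hb₃0 t)
      (hGpos t).ne' (right_ne_zero_of_mul hc) fun u => by
        obtain ⟨e₁, -, e₃⟩ := h u
        linear_combination G u * c₃ * e₁ - c₁ * e₃
    obtain ⟨e₁, e₂, e₃⟩ := h t
    have hprod : b₁ t * b₃ t = (s * D t) ^ 2 * (c₁ * c₃) := by
      linear_combination b₁ t * e₃ + D t * c₃ * e₁ - D t ^ 2 * c₁ * c₃ * hs
    rw [← hlog, e₂, hprod, abs_mul _ (c₁ * c₃), abs_sq, Real.sqrt_mul (sq_nonneg _),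
      Real.sqrt_sq (hsD t).le]
    field_simp
    linear_combination -(D t * c₂) * hs
  · rintro ⟨K, hK⟩
    obtain ⟨s₁, hs₁, hp₁⟩ := exists_sign_of_continuous_ne_zero hb₁.continuous hb₁0
    obtain ⟨s₃, hs₃, hp₃⟩ := exists_sign_of_continuous_ne_zero hb₃.continuous hb₃0
    have hs₁0 : s₁ ≠ 0 := left_ne_zero_of_mul_eq_one hs₁
    have hs₃0 : s₃ ≠ 0 := left_ne_zero_of_mul_eq_one hs₃
    have hpos : ∀ t, 0 < (s₁ * b₁ t) * (s₃ * b₃ t) := fun t => mul_pos (hp₁ t) (hp₃ t)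
    have habs : ∀ t, |b₁ t * b₃ t| = (s₁ * b₁ t) * (s₃ * b₃ t) := fun t => by
      rw [← abs_of_pos (hpos t), ← sq_eq_sq₀ (abs_nonneg _) (abs_nonneg _), sq_abs, sq_abs]
      linear_combination -(b₁ t * b₃ t) ^ 2 * (s₃ ^ 2 * hs₁ + hs₃)
    simp only [habs] at hK
    set D : ℝ → ℝ := fun t => √((s₁ * b₁ t) * (s₃ * b₃ t)) with hDdef
    have hD : Differentiable ℝ D :=
      ((hb₁.const_mul s₁).mul (hb₃.const_mul s₃)).sqrt fun t => (hpos t).ne'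
    have hDpos : ∀ t, 0 < D t := fun t => Real.sqrt_pos.mpr (hpos t)
    have hDsq : ∀ t, D t ^ 2 = (s₁ * b₁ t) * (s₃ * b₃ t) := fun t => Real.sq_sqrt (hpos t).le
    set G : ℝ → ℝ := fun t => D t / (s₁ * b₁ t) with hGdef
    have hG : Differentiable ℝ G := hD.div (hb₁.const_mul s₁) fun t => (hp₁ t).ne'
    have hGpos : ∀ t, 0 < G t := fun t => div_pos (hDpos t) (hp₁ t)
    have e₁ : ∀ t, G t * b₁ t = D t * s₁ := fun t => by
      have := hb₁0 t
      simp only [hGdef]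
      field_simp
      linear_combination -D t * hs₁
    have e₃ : ∀ t, b₃ t = G t * D t * s₃ := fun t => by
      have := hb₁0 t
      simp only [hGdef]
      field_simp
      linear_combination -s₃ * hDsq t - s₁ * b₁ t * b₃ t * hs₃
    refine ⟨s₁, K, s₃, D, G, mul_ne_zero hs₁0 hs₃0, hD, fun t => (hDpos t).ne', hG, hGpos,
      fun t => ⟨e₁ t, ?_, e₃ t⟩⟩
    rw [deriv_div_self_of_sq_mul_eq (a := s₁) (hb₁ t) (hb₃ t) (hG t) (hb₁0 t) (hb₃0 t)
      (hGpos t).ne' hs₃0 fun u => by linear_combination G u * s₃ * e₁ u - s₁ * e₃ u, hK t]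
    exact mul_comm _ _
end

section
/- Let b₁, b₂, b₃ : ℝ → ℝ be differentiable with b₃(t) ≠ 0 for all t, and let c₁, c₂, c₃ ∈ ℝ with c₃ ≠ 0. The following are equivalent: (a) there exist a differentiable nowhere-vanishing D : ℝ → ℝ and differentiable G, H : ℝ → ℝ with G(t) > 0 such that for all t and all x ∈ ℝ, G'(t)x + H'(t) + G(t)(b₁(t) + b₂(t)x + b₃(t)x²) = D(t)(c₁ + c₂(G(t)x + H(t)) + c₃(G(t)x + H(t))²) (i.e., the affine change of variables x̃ = G(t)x + H(t) transforms the Riccati equation ẋ = b₁ + b₂x + b₃x² into ẋ̃ = D(t)(c₁ + c₂x̃ + c₃x̃²)); (b) there exist a differentiable D : ℝ → ℝ with D(t)b₃(t)c₃ > 0 for all t and a differentiable M : ℝ → ℝ satisfying the system D' = (b₂ + b₃'/b₃)D − c₂D² − 2b₃MD and M' = −b₁ + (c₁c₃/b₃)D² + b₂M − b₃M². Moreover, in that case the transformation is given by x̃ = (b₃/(D c₃))(x + M), i.e. G = b₃/(Dc₃) and H = GM. -/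
theorem quadratic_coeffs_eq_of_forall_eq {a b c a' b' c' : ℝ}
    (h : ∀ x : ℝ, a + b * x + c * x ^ 2 = a' + b' * x + c' * x ^ 2) :
    a = a' ∧ b = b' ∧ c = c' := by
  have h0 := h 0
  have h1 := h 1
  have h2 := h (-1)
  norm_num at h0 h1 h2
  refine ⟨h0, ?_, ?_⟩ <;> linarith

/-- A solution `(D, M)` of the auxiliary system yields the affine change of variables
`x̃ = (b₃/(Dc₃))(x + M)`. -/
theorem riccati_affine_identity_of_system
    {b₁ b₂ b₃ D M : ℝ → ℝ} {c₁ c₂ c₃ t : ℝ}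
    (hb₃ : DifferentiableAt ℝ b₃ t) (hD : DifferentiableAt ℝ D t)
    (hM : DifferentiableAt ℝ M t)
    (hb3 : b₃ t ≠ 0) (hD0 : D t ≠ 0) (hc3 : c₃ ≠ 0)
    (hD' : deriv D t
      = (b₂ t + deriv b₃ t / b₃ t) * D t - c₂ * D t ^ 2 - 2 * b₃ t * M t * D t)
    (hM' : deriv M t
      = -b₁ t + (c₁ * c₃ / b₃ t) * D t ^ 2 + b₂ t * M t - b₃ t * M t ^ 2) (x : ℝ) :
    deriv (fun s => b₃ s / (D s * c₃)) t * x
        + deriv (fun s => (b₃ s / (D s * c₃)) * M s) t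
        + (b₃ t / (D t * c₃)) * (b₁ t + b₂ t * x + b₃ t * x ^ 2)
      = D t * (c₁ + c₂ * ((b₃ t / (D t * c₃)) * x + (b₃ t / (D t * c₃)) * M t)
          + c₃ * ((b₃ t / (D t * c₃)) * x + (b₃ t / (D t * c₃)) * M t) ^ 2) := by
  have hG := hb₃.hasDerivAt.fun_div (hD.hasDerivAt.mul_const c₃) (mul_ne_zero hD0 hc3)
  rw [(hG.fun_mul hM.hasDerivAt).deriv, hG.deriv, hD', hM']
  field_simp
  ring

/-- An affine change of variables `x̃ = G x + H` between the two Riccati equations yields the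
solution `(D, H/G)` of the auxiliary system. -/
theorem riccati_system_of_affine_identity
    {b₁ b₂ b₃ D G H : ℝ → ℝ} {c₁ c₂ c₃ : ℝ}
    (hD : Differentiable ℝ D) (hG : Differentiable ℝ G) (hH : Differentiable ℝ H)
    (hD0 : ∀ t, D t ≠ 0) (hG0 : ∀ t, G t ≠ 0) (hc3 : c₃ ≠ 0)
    (h : ∀ t x : ℝ, deriv G t * x + deriv H t + G t * (b₁ t + b₂ t * x + b₃ t * x ^ 2)
      = D t * (c₁ + c₂ * (G t * x + H t) + c₃ * (G t * x + H t) ^ 2)) :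
    (∀ t, b₃ t = D t * c₃ * G t) ∧
    (∀ t, deriv D t = (b₂ t + deriv b₃ t / b₃ t) * D t - c₂ * D t ^ 2
      - 2 * b₃ t * (H t / G t) * D t) ∧
    (∀ t, deriv (fun s => H s / G s) t = -b₁ t + (c₁ * c₃ / b₃ t) * D t ^ 2
      + b₂ t * (H t / G t) - b₃ t * (H t / G t) ^ 2) := by
  have coeffs (t : ℝ) :
      deriv H t + G t * b₁ t = D t * (c₁ + c₂ * H t + c₃ * H t ^ 2) ∧
      deriv G t + G t * b₂ t = D t * (c₂ * G t + 2 * c₃ * G t * H t) ∧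
      G t * b₃ t = D t * c₃ * G t ^ 2 :=
    quadratic_coeffs_eq_of_forall_eq fun x => by linear_combination h t x
  have hb (t : ℝ) : b₃ t = D t * c₃ * G t :=
    mul_left_cancel₀ (hG0 t) (by linear_combination (coeffs t).2.2)
  refine ⟨hb, fun t => ?_, fun t => ?_⟩
  · have hb' : deriv b₃ t = deriv D t * c₃ * G t + D t * c₃ * deriv G t := by
      rw [funext hb]
      exact (((hD t).hasDerivAt.mul_const c₃).fun_mul (hG t).hasDerivAt).deriv
    have hG' : deriv G t = D t * (c₂ * G t + 2 * c₃ * G t * H t) - G t * b₂ t := by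
      linear_combination (coeffs t).2.1
    have := hD0 t
    have := hG0 t
    rw [hb', hb t, hG']
    field_simp
    ring
  · have hG' : deriv G t = D t * (c₂ * G t + 2 * c₃ * G t * H t) - G t * b₂ t := by
      linear_combination (coeffs t).2.1
    have hH' : deriv H t = D t * (c₁ + c₂ * H t + c₃ * H t ^ 2) - G t * b₁ t := by
      linear_combination (coeffs t).1
    have := hD0 t
    have := hG0 t
    rw [((hH t).hasDerivAt.fun_div (hG t).hasDerivAt (hG0 t)).deriv, hb t, hG', hH']
    field_simp
    ring

/-- A Riccati equation with `b₃ ≠ 0` can be transformed by an affine time-dependent change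
of variables `x̃ = G(t)x + H(t)` (with `G > 0`) into `ẋ̃ = D(t)(c₁ + c₂x̃ + c₃x̃²)` if and
only if there exist functions `D`, `M` solving the auxiliary system
`D' = (b₂ + b₃'/b₃)D − c₂D² − 2b₃MD`, `M' = −b₁ + (c₁c₃/b₃)D² + b₂M − b₃M²`;
in that case the transformation is `x̃ = (b₃/(Dc₃))(x + M)`. -/
theorem riccati_affine_reduction
    (b₁ b₂ b₃ : ℝ → ℝ) (c₁ c₂ c₃ : ℝ)
    (hb₁ : Differentiable ℝ b₁) (hb₂ : Differentiable ℝ b₂) (hb₃ : Differentiable ℝ b₃)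
    (hb3 : ∀ t, b₃ t ≠ 0) (hc3 : c₃ ≠ 0) :
    ((∃ D G H : ℝ → ℝ, Differentiable ℝ D ∧ (∀ t, D t ≠ 0) ∧
        Differentiable ℝ G ∧ Differentiable ℝ H ∧ (∀ t, 0 < G t) ∧
        ∀ t x : ℝ, deriv G t * x + deriv H t + G t * (b₁ t + b₂ t * x + b₃ t * x ^ 2)
          = D t * (c₁ + c₂ * (G t * x + H t) + c₃ * (G t * x + H t) ^ 2)) ↔
      (∃ D M : ℝ → ℝ, Differentiable ℝ D ∧ Differentiable ℝ M ∧
        (∀ t, 0 < D t * b₃ t * c₃) ∧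
        (∀ t, deriv D t
          = (b₂ t + deriv b₃ t / b₃ t) * D t - c₂ * D t ^ 2 - 2 * b₃ t * M t * D t) ∧
        (∀ t, deriv M t
          = -b₁ t + (c₁ * c₃ / b₃ t) * D t ^ 2 + b₂ t * M t - b₃ t * M t ^ 2))) ∧
    (∀ D M : ℝ → ℝ, Differentiable ℝ D → Differentiable ℝ M →
      (∀ t, 0 < D t * b₃ t * c₃) →
      (∀ t, deriv D t
        = (b₂ t + deriv b₃ t / b₃ t) * D t - c₂ * D t ^ 2 - 2 * b₃ t * M t * D t) →
      (∀ t, deriv M t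
        = -b₁ t + (c₁ * c₃ / b₃ t) * D t ^ 2 + b₂ t * M t - b₃ t * M t ^ 2) →
      ∀ t x : ℝ,
        deriv (fun s => b₃ s / (D s * c₃)) t * x
            + deriv (fun s => (b₃ s / (D s * c₃)) * M s) t
            + (b₃ t / (D t * c₃)) * (b₁ t + b₂ t * x + b₃ t * x ^ 2)
          = D t * (c₁ + c₂ * ((b₃ t / (D t * c₃)) * x + (b₃ t / (D t * c₃)) * M t)
              + c₃ * ((b₃ t / (D t * c₃)) * x + (b₃ t / (D t * c₃)) * M t) ^ 2)) := by
  have ne_zero {D : ℝ → ℝ} (hpos : ∀ t, 0 < D t * b₃ t * c₃) (t : ℝ) : D t ≠ 0 :=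
    left_ne_zero_of_mul (left_ne_zero_of_mul (hpos t).ne')
  refine ⟨⟨?_, ?_⟩, fun D M hD hM hpos hD' hM' t x =>
    riccati_affine_identity_of_system (hb₃ t) (hD t) (hM t) (hb3 t) (ne_zero hpos t) hc3
      (hD' t) (hM' t) x⟩
  · rintro ⟨D, G, H, hD, hD0, hG, hH, hGpos, h⟩
    have hG0 (t : ℝ) : G t ≠ 0 := (hGpos t).ne'
    obtain ⟨hb, hD', hM'⟩ := riccati_system_of_affine_identity hD hG hH hD0 hG0 hc3 h
    refine ⟨D, fun s => H s / G s, hD, hH.fun_div hG hG0, fun t => ?_, hD', hM'⟩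
    have hsq : D t * b₃ t * c₃ = (D t * c₃) ^ 2 * G t := by
      rw [hb t]
      ring
    rw [hsq]
    exact mul_pos (sq_pos_of_ne_zero (mul_ne_zero (hD0 t) hc3)) (hGpos t)
  · rintro ⟨D, M, hD, hM, hpos, hD', hM'⟩
    have hD0 := ne_zero hpos
    have hG : Differentiable ℝ fun s => b₃ s / (D s * c₃) :=
      hb₃.fun_div (hD.mul_const c₃) fun t => mul_ne_zero (hD0 t) hc3
    refine ⟨D, _, _, hD, hD0, hG, hG.fun_mul hM, fun t => ?_, fun t x =>
      riccati_affine_identity_of_system (hb₃ t) (hD t) (hM t) (hb3 t) (hD0 t) hc3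
        (hD' t) (hM' t) x⟩
    have := hD0 t
    have hsq : b₃ t / (D t * c₃) = D t * b₃ t * c₃ / (D t * c₃) ^ 2 := by
      field_simp
    rw [hsq]
    exact div_pos (hpos t) (sq_pos_of_ne_zero (mul_ne_zero (hD0 t) hc3))
end

section
/- Let b₁, b₂, b₃ : ℝ → ℝ with b₁(t)b₃(t) ≠ 0 for all t. The following are equivalent: (i) there exist constants α, β, γ, δ ∈ ℝ with αδ − βγ = 1 such that δ²b₃(t) − δγb₂(t) + γ²b₁(t) = 0 for all t (i.e., the constant linear fractional transformation x ↦ (αx + β)/(γx + δ) transforms the Riccati equation ẋ = b₁ + b₂x + b₃x² into an equation with vanishing quadratic coefficient, hence into a linear differential equation); (ii) there exists a constant K ∈ ℝ with b₁(t) + b₂(t)K + b₃(t)K² = 0 for all t (i.e., the Riccati equation admits the constant particular solution x(t) = K). -/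
/-- A Riccati equation with `b₁b₃ ≠ 0` is linearisable by a constant linear fractional
transformation `x ↦ (αx + β)/(γx + δ)` with `αδ − βγ = 1` (i.e. the transformed quadratic
coefficient `δ²b₃ − δγb₂ + γ²b₁` vanishes identically) if and only if it admits a constant
particular solution `x(t) = K`. -/
theorem riccati_linearisable_iff_constant_solution
    (b₁ b₂ b₃ : ℝ → ℝ) (hb : ∀ t, b₁ t * b₃ t ≠ 0) :
    (∃ α β γ δ : ℝ, α * δ - β * γ = 1 ∧
        ∀ t, δ ^ 2 * b₃ t - δ * γ * b₂ t + γ ^ 2 * b₁ t = 0) ↔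
      (∃ K : ℝ, ∀ t, b₁ t + b₂ t * K + b₃ t * K ^ 2 = 0) := by
  constructor
  · rintro ⟨α, β, γ, δ, hdet, h⟩
    have hγ : γ ≠ 0 := by
      rintro rfl
      have hδ : δ ≠ 0 := by
        rintro rfl
        simp at hdet
      have h₀ : δ ^ 2 * b₃ 0 = 0 := by simpa using h 0
      exact mul_ne_zero (pow_ne_zero 2 hδ) (right_ne_zero_of_mul (hb 0)) h₀
    refine ⟨-δ / γ, fun t => ?_⟩
    field_simp
    linear_combination h t
  · rintro ⟨K, h⟩
    exact ⟨0, -1, 1, -K, by ring, fun t => by linear_combination h t⟩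
end

section
/- Let b₁, b₂, b₃, b̃₁, b̃₂, b̃₃ : ℝ → ℝ be continuous. If α, β, γ, δ : ℝ → ℝ are differentiable and satisfy, for all t, the linear system α' = ((b̃₂ − b₂)/2)α + b₃β + b̃₁γ, β' = −b₁α + ((b̃₂ + b₂)/2)β + b̃₁δ, γ' = −b̃₃α − ((b̃₂ + b₂)/2)γ + b₃δ, δ' = −b̃₃β − b₁γ − ((b̃₂ − b₂)/2)δ, then the determinant t ↦ α(t)δ(t) − β(t)γ(t) is a constant function. In particular, every solution with α(0)δ(0) − β(0)γ(0) = 1 stays in SL(2,ℝ), so the curves in SL(2,ℝ) transforming the equation on SL(2,ℝ) determined by the Riccati coefficients (b₁,b₂,b₃) into the one determined by (b̃₁,b̃₂,b̃₃) are exactly the solutions of this system with unit initial determinant. -/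
/-- For any solution `(α, β, γ, δ)` of the linear system describing the curves in
`SL(2,ℝ)` that transform the equation on `SL(2,ℝ)` determined by the Riccati coefficients
`(b₁, b₂, b₃)` into the one determined by `(d₁, d₂, d₃)`, the determinant `αδ − βγ` is
constant in time; in particular solutions with unit initial determinant stay in `SL(2,ℝ)`. -/
theorem transformation_system_det_constant
    (b₁ b₂ b₃ d₁ d₂ d₃ : ℝ → ℝ)
    (hb₁ : Continuous b₁) (hb₂ : Continuous b₂) (hb₃ : Continuous b₃)
    (hd₁ : Continuous d₁) (hd₂ : Continuous d₂) (hd₃ : Continuous d₃)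
    (α β γ δ : ℝ → ℝ)
    (hα : ∀ t, HasDerivAt α (((d₂ t - b₂ t) / 2) * α t + b₃ t * β t + d₁ t * γ t) t)
    (hβ : ∀ t, HasDerivAt β (-b₁ t * α t + ((d₂ t + b₂ t) / 2) * β t + d₁ t * δ t) t)
    (hγ : ∀ t, HasDerivAt γ (-d₃ t * α t - ((d₂ t + b₂ t) / 2) * γ t + b₃ t * δ t) t)
    (hδ : ∀ t, HasDerivAt δ (-d₃ t * β t - b₁ t * γ t - ((d₂ t - b₂ t) / 2) * δ t) t) :
    (∃ c : ℝ, ∀ t, α t * δ t - β t * γ t = c) ∧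
    (α 0 * δ 0 - β 0 * γ 0 = 1 → ∀ t, α t * δ t - β t * γ t = 1) := by
  have hdet (t : ℝ) : HasDerivAt (fun t => α t * δ t - β t * γ t) 0 t :=
    (((hα t).mul (hδ t)).sub ((hβ t).mul (hγ t))).congr_deriv (by ring)
  have hconst (t : ℝ) : α t * δ t - β t * γ t = α 0 * δ 0 - β 0 * γ 0 :=
    is_const_of_deriv_eq_zero (fun s => (hdet s).differentiableAt)
      (fun s => (hdet s).deriv) t 0
  exact ⟨⟨_, hconst⟩, fun h t => (hconst t).trans h⟩
end

section
/- Let V be a real vector subspace of the space of smooth functions ℝ → ℝ (viewed as vector fields f(x)·d/dx on ℝ) which contains the functions x ↦ x² and x ↦ x³ and is closed under the Lie bracket [f, g](x) = f(x)g'(x) − g(x)f'(x). Then V is infinite-dimensional. Consequently, the Abel equation ẋ = x² + b(t)x³ with b(t) ≠ 0 nonconstant is not a Lie system: the Lie algebra of vector fields generated by the family {x²∂ₓ + b(t)x³∂ₓ}_{t∈ℝ} is infinite-dimensional. -/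
open Polynomial in
/-- A space of real functions containing all monomials of degree at least two is
infinite-dimensional. -/
theorem not_finiteDimensional_of_pow_mem (V : Submodule ℝ (ℝ → ℝ))
    (hV : ∀ n : ℕ, (fun x : ℝ => x ^ (n + 2)) ∈ V) : ¬ FiniteDimensional ℝ V := by
  intro _
  let φ : ℝ[X] →ₗ[ℝ] (ℝ → ℝ) :=
    { toFun := fun p x => (p * X ^ 2).eval x
      map_add' := fun p q => by ext x; simp [add_mul]
      map_smul' := fun c p => by ext x; simp }
  have hφ : ∀ p, φ p ∈ V := by
    intro p
    induction p using Polynomial.induction_on' with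
    | add p q hp hq => simpa only [map_add] using V.add_mem hp hq
    | monomial n a =>
      convert V.smul_mem a (hV n) using 1
      ext x
      simp [φ, pow_add, mul_assoc]
  have hinj : Function.Injective (φ.codRestrict V hφ) := by
    intro p q h
    have h' : φ p = φ q := congrArg Subtype.val h
    exact mul_right_cancel₀ (pow_ne_zero 2 X_ne_zero) (Polynomial.funext (congrFun h'))
  exact Polynomial.not_finite (Module.Finite.of_injective _ hinj)

/-- A space of real functions closed under the bracket `f g' - g f'` and containing `x ^ 2`
and `x ^ 3` contains all monomials of degree at least two. -/
theorem pow_mem_of_bracket_mem (V : Submodule ℝ (ℝ → ℝ))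
    (h2 : (fun x : ℝ => x ^ 2) ∈ V) (h3 : (fun x : ℝ => x ^ 3) ∈ V)
    (hbr : ∀ f ∈ V, ∀ g ∈ V, (fun x : ℝ => f x * deriv g x - g x * deriv f x) ∈ V) (n : ℕ) :
    (fun x : ℝ => x ^ (n + 2)) ∈ V := by
  induction n with
  | zero => exact h2
  | succ n ih =>
    rcases Nat.eq_zero_or_pos n with rfl | hn
    · exact h3
    · have hn' : (n : ℝ) ≠ 0 := by positivity
      convert V.smul_mem (n : ℝ)⁻¹ (hbr _ h2 _ ih) using 1
      ext x
      simp only [Pi.smul_apply, smul_eq_mul, deriv_pow_field]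
      push_cast
      field_simp
      ring

/-- (1) Every real vector subspace of the space of smooth functions on `ℝ` (viewed as
vector fields `f(x)·d/dx`) containing `x ↦ x²` and `x ↦ x³` and closed under the Lie
bracket `[f,g] = f g' − g f'` is infinite-dimensional.  (2) Consequently, for any
nowhere-vanishing nonconstant `b`, the Abel equation `ẋ = x² + b(t)x³` is not a Lie
system: any Lie algebra of smooth vector fields containing the family
`{x² + b(t)x³}_{t∈ℝ}` is infinite-dimensional. -/
theorem abel_not_lie_system :
    (∀ V : Submodule ℝ (ℝ → ℝ),
      (∀ f ∈ V, ContDiff ℝ (⊤ : ℕ∞) f) →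
      (fun x : ℝ => x ^ 2) ∈ V →
      (fun x : ℝ => x ^ 3) ∈ V →
      (∀ f ∈ V, ∀ g ∈ V, (fun x : ℝ => f x * deriv g x - g x * deriv f x) ∈ V) →
      ¬ FiniteDimensional ℝ V) ∧
    (∀ b : ℝ → ℝ, (∀ t, b t ≠ 0) → (¬ ∃ c : ℝ, ∀ t, b t = c) →
      ∀ V : Submodule ℝ (ℝ → ℝ),
        (∀ f ∈ V, ContDiff ℝ (⊤ : ℕ∞) f) →
        (∀ f ∈ V, ∀ g ∈ V, (fun x : ℝ => f x * deriv g x - g x * deriv f x) ∈ V) →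
        (∀ t : ℝ, (fun x : ℝ => x ^ 2 + b t * x ^ 3) ∈ V) →
        ¬ FiniteDimensional ℝ V) := by
  have main : ∀ V : Submodule ℝ (ℝ → ℝ), (fun x : ℝ => x ^ 2) ∈ V → (fun x : ℝ => x ^ 3) ∈ V →
      (∀ f ∈ V, ∀ g ∈ V, (fun x : ℝ => f x * deriv g x - g x * deriv f x) ∈ V) →
      ¬ FiniteDimensional ℝ V := fun V h2 h3 hbr =>
    not_finiteDimensional_of_pow_mem V (pow_mem_of_bracket_mem V h2 h3 hbr)
  refine ⟨fun V _ => main V, fun b _ hb V _ hbr hmem => ?_⟩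
  obtain ⟨t, ht⟩ : ∃ t, b t ≠ b 0 := by
    by_contra! h
    exact hb ⟨b 0, h⟩
  have h3 : (fun x : ℝ => x ^ 3) ∈ V := by
    have ht' : b t - b 0 ≠ 0 := sub_ne_zero.mpr ht
    convert V.smul_mem (b t - b 0)⁻¹ (V.sub_mem (hmem t) (hmem 0)) using 1
    ext x
    simp only [Pi.smul_apply, Pi.sub_apply, smul_eq_mul]
    field_simp
    ring
  have h2 : (fun x : ℝ => x ^ 2) ∈ V := by
    convert V.sub_mem (hmem 0) (V.smul_mem (b 0) h3) using 1
    ext x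
    simp
  exact main V h2 h3 hbr
end

section
/- Let ω : ℝ → ℝ, let k ∈ ℝ, and let x₁, x₂ : ℝ → ℝ be twice-differentiable nowhere-vanishing solutions of the Milne–Pinney equation ẍᵢ(t) = −ω(t)²xᵢ(t) + k/xᵢ(t)³ (i = 1, 2). Then the function t ↦ (x₁(t)ẋ₂(t) − x₂(t)ẋ₁(t))² + k((x₂(t)/x₁(t))² + (x₁(t)/x₂(t))²) is a constant function of t. -/
/-- For any two nowhere-vanishing solutions `x₁, x₂` of the Milne–Pinney equation
`ẍ = −ω²(t)x + k/x³`, the quantity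
`(x₁ẋ₂ − x₂ẋ₁)² + k((x₂/x₁)² + (x₁/x₂)²)` is a constant of the motion. -/
theorem milne_pinney_invariant
    (ω : ℝ → ℝ) (k : ℝ) (x₁ x₂ v₁ v₂ : ℝ → ℝ)
    (hx₁0 : ∀ t, x₁ t ≠ 0) (hx₂0 : ∀ t, x₂ t ≠ 0)
    (hx₁ : ∀ t, HasDerivAt x₁ (v₁ t) t)
    (hv₁ : ∀ t, HasDerivAt v₁ (-(ω t ^ 2) * x₁ t + k / x₁ t ^ 3) t)
    (hx₂ : ∀ t, HasDerivAt x₂ (v₂ t) t)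
    (hv₂ : ∀ t, HasDerivAt v₂ (-(ω t ^ 2) * x₂ t + k / x₂ t ^ 3) t) :
    ∃ c : ℝ, ∀ t : ℝ,
      (x₁ t * v₂ t - x₂ t * v₁ t) ^ 2
        + k * ((x₂ t / x₁ t) ^ 2 + (x₁ t / x₂ t) ^ 2) = c := by
  have hderiv (t : ℝ) : HasDerivAt (fun t => (x₁ t * v₂ t - x₂ t * v₁ t) ^ 2
      + k * ((x₂ t / x₁ t) ^ 2 + (x₁ t / x₂ t) ^ 2)) 0 t := by
    have h₁ := hx₁0 t
    have h₂ := hx₂0 t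
    have hW := (((hx₁ t).fun_mul (hv₂ t)).fun_sub ((hx₂ t).fun_mul (hv₁ t))).fun_pow 2
    have hR := (((hx₂ t).fun_div (hx₁ t) h₁).fun_pow 2).fun_add
      (((hx₁ t).fun_div (hx₂ t) h₂).fun_pow 2)
    refine (hW.fun_add (hR.const_mul k)).congr_deriv ?_
    simp only [Nat.cast_ofNat, Nat.add_one_sub_one, pow_one]
    field_simp
    ring
  exact ⟨_, fun t => is_const_of_deriv_eq_zero (fun s => (hderiv s).differentiableAt)
    (fun s => (hderiv s).deriv) t 0⟩
end

section
/- (New superposition rule for the Milne–Pinney equation) Let ω : ℝ → ℝ, let k > 0, and let x₁, x₂ : ℝ → ℝ be twice-differentiable solutions of ẍᵢ = −ω(t)²xᵢ + k/xᵢ³ with x₁(t) > 0 and x₂(t) > 0 for all t. Let I₃ ∈ ℝ be such that (x₁ẋ₂ − x₂ẋ₁)² + k((x₂/x₁)² + (x₁/x₂)²) = I₃ for all t, and assume I₃ > 2k. Let k₁, k₂ ∈ ℝ, set λ₁₂ = (k₁k₂I₃ + k(k₁² + k₂² − 1))/(I₃² − 4k²), and let ε ∈ {+1, −1}. If J is an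 open interval on which λ₁₂·(−k(x₁⁴ + x₂⁴) + I₃x₁²x₂²) > 0 and k₁x₁² + k₂x₂² + 2ε√(λ₁₂(−k(x₁⁴ + x₂⁴) + I₃x₁²x₂²)) > 0, then the function x(t) = √(k₁x₁(t)² + k₂x₂(t)² + 2ε√(λ₁₂(−k(x₁(t)⁴ + x₂(t)⁴) + I₃x₁(t)²x₂(t)²))) satisfies ẍ(t) = −ω(t)²x(t) + k/x(t)³ for all t ∈ J. -/
/-- A positive `u` with `u u'' / 2 - u'² / 4 + ω² u² = k` has a square root solving the
Milne–Pinney equation. -/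
theorem milnePinney_sqrt {u u' : ℝ → ℝ} {t u'' w k : ℝ}
    (hu : ∀ s, HasDerivAt u (u' s) s) (hu' : HasDerivAt u' u'' t) (hpos : 0 < u t)
    (h : u t * u'' / 2 - u' t ^ 2 / 4 + w ^ 2 * u t ^ 2 = k) :
    HasDerivAt (fun s => u' s / (2 * √(u s)))
      (-(w ^ 2) * √(u t) + k / √(u t) ^ 3) t := by
  have hr : 0 < √(u t) := Real.sqrt_pos.2 hpos
  have hsq : √(u t) ^ 2 = u t := Real.sq_sqrt hpos.le
  refine (hu'.fun_div (((hu t).sqrt hpos.ne').const_mul 2) (by positivity)).congr_deriv ?_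
  rw [← h]
  generalize √(u t) = r at *
  rw [← hsq]
  field_simp
  ring

/-- Squares of solutions and their Wronskian generate the solution space of the third-order linear
equation attached to the Milne–Pinney equation; the quadratic form `u u'' / 2 - u'² / 4 + ω² u²` is
evaluated here on a general element of that space. -/
theorem milnePinney_quadratic_identity {a b p q w k I c k₁ k₂ : ℝ} (ha : 0 < a) (hb : 0 < b)
    (hI : (a * q - b * p) ^ 2 + k * ((b / a) ^ 2 + (a / b) ^ 2) = I)
    (hc : c ^ 2 * (I ^ 2 - 4 * k ^ 2) = k₁ * k₂ * I + k * (k₁ ^ 2 + k₂ ^ 2 - 1)) :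
    (k₁ * a ^ 2 + k₂ * b ^ 2 + 2 * c * (a * b * (a * q - b * p))) *
        (k₁ * (2 * (p * p + a * (-(w ^ 2) * a + k / a ^ 3))) +
          k₂ * (2 * (q * q + b * (-(w ^ 2) * b + k / b ^ 3))) +
          2 * c * (((-(w ^ 2) * a + k / a ^ 3) * b + 2 * (p * q)
              + a * (-(w ^ 2) * b + k / b ^ 3)) * (a * q - b * p)
            + 2 * ((p * b + a * q) * (k * (a / b ^ 3 - b / a ^ 3)))
            + a * b * (k * (p / b ^ 3 - 3 * a * q / b ^ 4 - q / a ^ 3 + 3 * b * p / a ^ 4)))) / 2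
      - (k₁ * (2 * (a * p)) + k₂ * (2 * (b * q)) + 2 * c * ((p * b + a * q) * (a * q - b * p)
          + a * b * (k * (a / b ^ 3 - b / a ^ 3)))) ^ 2 / 4
      + w ^ 2 * (k₁ * a ^ 2 + k₂ * b ^ 2 + 2 * c * (a * b * (a * q - b * p))) ^ 2 = k := by
  have key : k = k₁ ^ 2 * k + k₂ ^ 2 * k + k₁ * k₂ * I - c ^ 2 * (I ^ 2 - 4 * k ^ 2) := by
    rw [hc]; ring
  refine Eq.trans ?_ key.symm
  rw [← hI]
  field_simp
  ring

/-- **New superposition rule for the Milne–Pinney equation**: given two positive solutions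
`x₁, x₂` of `ẍ = −ω²(t)x + k/x³` (with `k > 0`), the constant of the motion `I₃ > 2k`,
constants `k₁, k₂`, `λ₁₂ = (k₁k₂I₃ + k(k₁² + k₂² − 1))/(I₃² − 4k²)` and a sign `ε`, the
function `x = √(k₁x₁² + k₂x₂² + 2ε√(λ₁₂(−k(x₁⁴ + x₂⁴) + I₃x₁²x₂²)))` is again a solution
on any open interval where the radicands are positive. -/
theorem milne_pinney_superposition_rule
    (ω : ℝ → ℝ) (k : ℝ) (hk : 0 < k)
    (x₁ x₂ v₁ v₂ : ℝ → ℝ)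
    (hx₁pos : ∀ t, 0 < x₁ t) (hx₂pos : ∀ t, 0 < x₂ t)
    (hx₁ : ∀ t, HasDerivAt x₁ (v₁ t) t)
    (hv₁ : ∀ t, HasDerivAt v₁ (-(ω t ^ 2) * x₁ t + k / x₁ t ^ 3) t)
    (hx₂ : ∀ t, HasDerivAt x₂ (v₂ t) t)
    (hv₂ : ∀ t, HasDerivAt v₂ (-(ω t ^ 2) * x₂ t + k / x₂ t ^ 3) t)
    (I₃ : ℝ)
    (hI₃ : ∀ t, (x₁ t * v₂ t - x₂ t * v₁ t) ^ 2
      + k * ((x₂ t / x₁ t) ^ 2 + (x₁ t / x₂ t) ^ 2) = I₃)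
    (hI₃k : 2 * k < I₃)
    (k₁ k₂ lam : ℝ)
    (hlam : lam = (k₁ * k₂ * I₃ + k * (k₁ ^ 2 + k₂ ^ 2 - 1)) / (I₃ ^ 2 - 4 * k ^ 2))
    (ε : ℝ) (hε : ε = 1 ∨ ε = -1)
    (J : Set ℝ) (hJ : IsOpen J) (hJ' : J.OrdConnected)
    (hpos₁ : ∀ t ∈ J,
      0 < lam * (-(k * (x₁ t ^ 4 + x₂ t ^ 4)) + I₃ * x₁ t ^ 2 * x₂ t ^ 2))
    (hpos₂ : ∀ t ∈ J,
      0 < k₁ * x₁ t ^ 2 + k₂ * x₂ t ^ 2 + 2 * ε *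
        Real.sqrt (lam * (-(k * (x₁ t ^ 4 + x₂ t ^ 4)) + I₃ * x₁ t ^ 2 * x₂ t ^ 2)))
    (x : ℝ → ℝ)
    (hxdef : ∀ t, x t = Real.sqrt (k₁ * x₁ t ^ 2 + k₂ * x₂ t ^ 2 + 2 * ε *
      Real.sqrt (lam * (-(k * (x₁ t ^ 4 + x₂ t ^ 4)) + I₃ * x₁ t ^ 2 * x₂ t ^ 2)))) :
    ∃ v : ℝ → ℝ, ∀ t ∈ J,
      HasDerivAt x (v t) t ∧
      HasDerivAt v (-(ω t ^ 2) * x t + k / x t ^ 3) t := by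
  have hWd : ∀ t, HasDerivAt (fun s => x₁ s * v₂ s - x₂ s * v₁ s)
      (k * (x₁ t / x₂ t ^ 3 - x₂ t / x₁ t ^ 3)) t := fun t =>
    (((hx₁ t).fun_mul (hv₂ t)).fun_sub ((hx₂ t).fun_mul (hv₁ t))).congr_deriv (by ring)
  have hQ : ∀ t, -(k * (x₁ t ^ 4 + x₂ t ^ 4)) + I₃ * x₁ t ^ 2 * x₂ t ^ 2 =
      (x₁ t * x₂ t * (x₁ t * v₂ t - x₂ t * v₁ t)) ^ 2 := fun t => by
    have h₁ := hx₁pos t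
    have h₂ := hx₂pos t
    rw [← hI₃ t]
    field_simp
    ring
  have hD : 0 < I₃ ^ 2 - 4 * k ^ 2 := by nlinarith
  have local_solution : ∀ t ∈ J, ∃ z : ℝ → ℝ, (∀ᶠ s in nhds t, HasDerivAt x (z s) s) ∧
      HasDerivAt z (-(ω t ^ 2) * x t + k / x t ^ 3) t := by
    intro t ht
    have hp := hpos₁ t ht
    rw [hQ t] at hp
    have hlam0 : 0 < lam := pos_of_mul_pos_left hp (sq_nonneg _)
    have hW0 : x₁ t * v₂ t - x₂ t * v₁ t ≠ 0 := by
      intro h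
      simp [h] at hp
    obtain ⟨σ, hσ, hσW⟩ : ∃ σ : ℝ, σ ^ 2 = 1 ∧ ∀ᶠ s in nhds t,
        |x₁ s * v₂ s - x₂ s * v₁ s| = σ * (x₁ s * v₂ s - x₂ s * v₁ s) := by
      rcases hW0.lt_or_gt with h | h
      · refine ⟨-1, by norm_num, ?_⟩
        filter_upwards [(hWd t).continuousAt.eventually_lt_const h] with s hs
        rw [abs_of_neg hs]; ring
      · refine ⟨1, by norm_num, ?_⟩
        filter_upwards [(hWd t).continuousAt.eventually_const_lt h] with s hs
        rw [abs_of_pos hs]; ring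
    set c : ℝ := ε * σ * √lam with hc
    have hc2 : c ^ 2 = lam := by
      have hε2 : ε ^ 2 = 1 := by rcases hε with rfl | rfl <;> norm_num
      rw [hc, mul_pow, mul_pow, hε2, hσ, Real.sq_sqrt hlam0.le]; ring
    set u : ℝ → ℝ := fun s => k₁ * x₁ s ^ 2 + k₂ * x₂ s ^ 2 +
      2 * c * (x₁ s * x₂ s * (x₁ s * v₂ s - x₂ s * v₁ s)) with hu
    set u' : ℝ → ℝ := fun s => k₁ * (2 * (x₁ s * v₁ s)) + k₂ * (2 * (x₂ s * v₂ s)) +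
      2 * c * ((v₁ s * x₂ s + x₁ s * v₂ s) * (x₁ s * v₂ s - x₂ s * v₁ s) +
        x₁ s * x₂ s * (k * (x₁ s / x₂ s ^ 3 - x₂ s / x₁ s ^ 3))) with hu'
    have hrad : ∀ᶠ s in nhds t, k₁ * x₁ s ^ 2 + k₂ * x₂ s ^ 2 + 2 * ε *
        √(lam * (-(k * (x₁ s ^ 4 + x₂ s ^ 4)) + I₃ * x₁ s ^ 2 * x₂ s ^ 2)) = u s := by
      filter_upwards [hσW] with s hs
      rw [hQ s, Real.sqrt_mul hlam0.le, Real.sqrt_sq_eq_abs, abs_mul,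
        abs_of_pos (mul_pos (hx₁pos s) (hx₂pos s)), hs]
      simp only [hu, hc]
      ring
    have hxu : ∀ᶠ s in nhds t, x s = √(u s) := by
      filter_upwards [hrad] with s hs
      rw [hxdef s, hs]
    have hupos : ∀ᶠ s in nhds t, 0 < u s := by
      filter_upwards [hrad, hJ.mem_nhds ht] with s hs hsJ
      exact hs ▸ hpos₂ s hsJ
    have hud : ∀ s, HasDerivAt u (u' s) s := fun s =>
      (((((hx₁ s).fun_pow 2).const_mul k₁).fun_add (((hx₂ s).fun_pow 2).const_mul k₂)).fun_add
        ((((hx₁ s).fun_mul (hx₂ s)).fun_mul (hWd s)).const_mul (2 * c))).congr_deriv (by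
          simp only [hu']
          push_cast
          ring)
    refine ⟨fun s => u' s / (2 * √(u s)), ?_, ?_⟩
    · filter_upwards [hxu.eventually_nhds, hupos] with s hs hs0
      exact ((hud s).sqrt hs0.ne').congr_of_eventuallyEq hs
    · rw [hxu.self_of_nhds]
      have h₁ := hx₁pos t
      have h₂ := hx₂pos t
      refine milnePinney_sqrt hud ?_ hupos.self_of_nhds
        (milnePinney_quadratic_identity h₁ h₂ (hI₃ t) ?_)
      · have hWd' : HasDerivAt (fun s => k * (x₁ s / x₂ s ^ 3 - x₂ s / x₁ s ^ 3)) _ t :=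
          (((hx₁ t).fun_div ((hx₂ t).fun_pow 3) (by positivity)).fun_sub
            ((hx₂ t).fun_div ((hx₁ t).fun_pow 3) (by positivity))).const_mul k
        refine ((((((hx₁ t).fun_mul (hv₁ t)).const_mul 2).const_mul k₁).fun_add
          ((((hx₂ t).fun_mul (hv₂ t)).const_mul 2).const_mul k₂)).fun_add
          ((((((hv₁ t).fun_mul (hx₂ t)).fun_add ((hx₁ t).fun_mul (hv₂ t))).fun_mul
            (hWd t)).fun_add (((hx₁ t).fun_mul (hx₂ t)).fun_mul hWd')).const_mul
            (2 * c))).congr_deriv ?_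
        push_cast
        field_simp
        ring
      · rw [hc2, hlam, div_mul_cancel₀ _ hD.ne']
  refine ⟨deriv x, fun t ht => ?_⟩
  obtain ⟨z, hz, hz'⟩ := local_solution t ht
  exact ⟨hz.self_of_nhds.differentiableAt.hasDerivAt,
    hz'.congr_of_eventuallyEq (hz.mono fun s hs => hs.deriv)⟩
end

section
/- (Pinney's superposition rule) Let ω : ℝ → ℝ, let k ∈ ℝ, and let y₁, y₂ : ℝ → ℝ be twice-differentiable solutions of the harmonic oscillator equation ÿᵢ(t) = −ω(t)²yᵢ(t) (i = 1, 2). Let W ∈ ℝ be such that y₁(t)ẏ₂(t) − y₂(t)ẏ₁(t) = W for all t, with W ≠ 0, and let I₁, I₂ ∈ ℝ satisfy 4I₁I₂ − kW² ≥ 0. If J is an open interval on which Q(t) := I₂y₁(t)² + I₁y₂(t)² + √(4I₁I₂ − kW²)·y₁(t)y₂(t) > 0, then the function x(t) = (√2/|W|)·√(Q(t)) satisfies the Milne–Pinney equation ẍ(t) = −ω(t)²x(t) + k/x(t)³ for all t ∈ J. -/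
/-- **Pinney's superposition rule**: given two solutions `y₁, y₂` of the harmonic
oscillator `ÿ = −ω²(t)y` with constant Wronskian `W ≠ 0`, and constants `I₁, I₂` with
`4I₁I₂ − kW² ≥ 0`, the function `x = (√2/|W|)·√(I₂y₁² + I₁y₂² + √(4I₁I₂ − kW²)·y₁y₂)`
solves the Milne–Pinney equation `ẍ = −ω²(t)x + k/x³` on any open interval where the
radicand is positive. -/
theorem pinney_superposition_rule
    (ω : ℝ → ℝ) (k : ℝ)
    (y₁ y₂ u₁ u₂ : ℝ → ℝ)
    (hy₁ : ∀ t, HasDerivAt y₁ (u₁ t) t)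
    (hu₁ : ∀ t, HasDerivAt u₁ (-(ω t ^ 2) * y₁ t) t)
    (hy₂ : ∀ t, HasDerivAt y₂ (u₂ t) t)
    (hu₂ : ∀ t, HasDerivAt u₂ (-(ω t ^ 2) * y₂ t) t)
    (W : ℝ) (hW : ∀ t, y₁ t * u₂ t - y₂ t * u₁ t = W) (hW0 : W ≠ 0)
    (I₁ I₂ : ℝ) (hI : 0 ≤ 4 * I₁ * I₂ - k * W ^ 2)
    (J : Set ℝ) (hJ : IsOpen J) (hJ' : J.OrdConnected)
    (hQ : ∀ t ∈ J, 0 < I₂ * y₁ t ^ 2 + I₁ * y₂ t ^ 2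
      + Real.sqrt (4 * I₁ * I₂ - k * W ^ 2) * y₁ t * y₂ t)
    (x : ℝ → ℝ)
    (hxdef : ∀ t, x t = (Real.sqrt 2 / |W|) * Real.sqrt (I₂ * y₁ t ^ 2 + I₁ * y₂ t ^ 2
      + Real.sqrt (4 * I₁ * I₂ - k * W ^ 2) * y₁ t * y₂ t)) :
    ∃ v : ℝ → ℝ, ∀ t ∈ J,
      HasDerivAt x (v t) t ∧
      HasDerivAt v (-(ω t ^ 2) * x t + k / x t ^ 3) t := by
  set s := Real.sqrt (4 * I₁ * I₂ - k * W ^ 2) with hs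
  have hs2 : s ^ 2 = 4 * I₁ * I₂ - k * W ^ 2 := Real.sq_sqrt hI
  set Q : ℝ → ℝ := fun t => I₂ * y₁ t ^ 2 + I₁ * y₂ t ^ 2 + s * y₁ t * y₂ t with hQdef
  set B : ℝ → ℝ := fun t => I₂ * y₁ t * u₁ t + I₁ * y₂ t * u₂ t
    + s / 2 * (u₁ t * y₂ t + y₁ t * u₂ t) with hBdef
  have hdQ : ∀ t, HasDerivAt Q (2 * B t) t := fun t => by
    have h := ((((hy₁ t).pow 2).const_mul I₂).add (((hy₂ t).pow 2).const_mul I₁)).add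
      (((hy₁ t).const_mul s).mul (hy₂ t))
    refine h.congr_deriv ?_
    simp only [hBdef]
    push_cast
    ring
  have hdB : ∀ t, HasDerivAt B (I₂ * u₁ t ^ 2 + I₁ * u₂ t ^ 2 + s * u₁ t * u₂ t
      - ω t ^ 2 * Q t) t := fun t => by
    have h := ((((hy₁ t).const_mul I₂).mul (hu₁ t)).add
      (((hy₂ t).const_mul I₁).mul (hu₂ t))).add
      ((((hu₁ t).mul (hy₂ t)).add ((hy₁ t).mul (hu₂ t))).const_mul (s / 2))
    refine h.congr_deriv ?_
    simp only [hQdef]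
    ring
  have hx2 : ∀ t ∈ J, x t ^ 2 = 2 / W ^ 2 * Q t := fun t ht => by
    rw [hxdef, mul_pow, div_pow, Real.sq_sqrt (by norm_num), sq_abs,
      Real.sq_sqrt (hQ t ht).le]
  have hx0 : ∀ t ∈ J, x t ≠ 0 := fun t ht h => by
    have h2 := hx2 t ht
    have hQt : 0 < Q t := hQ t ht
    have : 0 < 2 / W ^ 2 * Q t := by positivity
    rw [← h2, h] at this
    norm_num at this
  have hdx : ∀ t ∈ J, HasDerivAt x (2 / W ^ 2 * B t / x t) t := fun t ht => by
    have hxe : x = fun t => Real.sqrt 2 / |W| * Real.sqrt (Q t) := funext hxdef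
    have hQt : 0 < Q t := hQ t ht
    have h := ((hdQ t).sqrt hQt.ne').const_mul (Real.sqrt 2 / |W|)
    rw [← hxe] at h
    refine h.congr_deriv ?_
    have hxt : x t = Real.sqrt 2 / |W| * Real.sqrt (Q t) := hxdef t
    have hW' : |W| ≠ 0 := abs_ne_zero.mpr hW0
    have hQ' : Real.sqrt (Q t) ≠ 0 := (Real.sqrt_pos.mpr hQt).ne'
    have h2 : Real.sqrt 2 ^ 2 = 2 := Real.sq_sqrt (by norm_num)
    rw [hxt, ← sq_abs W]
    field_simp
    linear_combination B t * h2
  refine ⟨fun t => 2 / W ^ 2 * B t / x t, fun t ht => ⟨hdx t ht, ?_⟩⟩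
  refine (((hdB t).const_mul (2 / W ^ 2)).div (hdx t ht) (hx0 t ht)).congr_deriv ?_
  have hxt := hx0 t ht
  have key : (I₂ * u₁ t ^ 2 + I₁ * u₂ t ^ 2 + s * u₁ t * u₂ t) * Q t - B t ^ 2
      = k * W ^ 4 / 4 := by
    have h : (I₂ * u₁ t ^ 2 + I₁ * u₂ t ^ 2 + s * u₁ t * u₂ t) * Q t - B t ^ 2
        = (4 * I₁ * I₂ - s ^ 2) / 4 * (y₁ t * u₂ t - y₂ t * u₁ t) ^ 2 := by
      simp only [hQdef, hBdef]
      ring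
    rw [h, hW t, hs2]
    ring
  have hnum : 2 / W ^ 2 * (I₂ * u₁ t ^ 2 + I₁ * u₂ t ^ 2 + s * u₁ t * u₂ t
      - ω t ^ 2 * Q t) * x t ^ 2 - (2 / W ^ 2 * B t) ^ 2
      = -(ω t ^ 2) * (x t ^ 2) ^ 2 + k := by
    rw [hx2 t ht]
    field_simp
    linear_combination 4 * key
  field_simp at hnum ⊢
  linear_combination hnum
end

section
/- (t-dependent superposition rule for dissipative Milne–Pinney equations) Let a, b : ℝ → ℝ be continuous, let k ∈ ℝ, and set α(t) = exp(∫₀ᵗ a(s)ds). Let y₁, y₂ : ℝ → ℝ be twice-differentiable solutions of ÿᵢ(t) = a(t)ẏᵢ(t) + b(t)yᵢ(t) (i = 1, 2), and let W₀ := y₁(0)ẏ₂(0) − y₂(0)ẏ₁(0) ≠ 0. Let I₁, I₂ ∈ ℝ with 4I₁I₂ − kW₀² ≥ 0. If J is an open interval containing no zeros of Q(t) := I₂y₁(t)² + I₁y₂(t)² + √(4I₁I₂ − kW₀²)·y₁(t)y₂(t) and Q(t) > 0 on J, then the function x(t) = (√2/|W₀|)·√(Q(t)) satisfies the dissipative Milne–Pinney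 equation ẍ(t) = a(t)ẋ(t) + b(t)x(t) + k·exp(2∫₀ᵗ a(s)ds)/x(t)³ for all t ∈ J. -/
/-- A solution of the scalar linear equation `ẇ = a(t)w` is `w(0)·exp(∫₀ᵗ a(s)ds)`. -/
theorem eq_mul_exp_integral_of_hasDerivAt {a w : ℝ → ℝ} (ha : Continuous a)
    (hw : ∀ t, HasDerivAt w (a t * w t) t) (t : ℝ) :
    w t = w 0 * Real.exp (∫ s in (0 : ℝ)..t, a s) := by
  have hA (t : ℝ) : HasDerivAt (fun r => ∫ s in (0 : ℝ)..r, a s) (a t) t :=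
    intervalIntegral.integral_hasDerivAt_right (ha.intervalIntegrable _ _)
      ha.aestronglyMeasurable.stronglyMeasurableAtFilter ha.continuousAt
  have hd (t : ℝ) : HasDerivAt (fun r => w r * Real.exp (-∫ s in (0 : ℝ)..r, a s)) 0 t := by
    refine ((hw t).mul (hA t).fun_neg.exp).congr_deriv ?_
    ring
  have h := is_const_of_deriv_eq_zero (fun r => (hd r).differentiableAt)
    (fun r => (hd r).deriv) t 0
  simp only [intervalIntegral.integral_same, neg_zero, Real.exp_zero, mul_one] at h
  rw [← h, mul_assoc, ← Real.exp_add, neg_add_cancel, Real.exp_zero, mul_one]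

/-- **Abel's identity**: the Wronskian of two solutions of `ÿ = a(t)ẏ + b(t)y`. -/
theorem wronskian_eq_mul_exp_integral {a b y₁ y₂ u₁ u₂ : ℝ → ℝ} (ha : Continuous a)
    (hy₁ : ∀ t, HasDerivAt y₁ (u₁ t) t)
    (hu₁ : ∀ t, HasDerivAt u₁ (a t * u₁ t + b t * y₁ t) t)
    (hy₂ : ∀ t, HasDerivAt y₂ (u₂ t) t)
    (hu₂ : ∀ t, HasDerivAt u₂ (a t * u₂ t + b t * y₂ t) t) (t : ℝ) :
    y₁ t * u₂ t - y₂ t * u₁ t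
      = (y₁ 0 * u₂ 0 - y₂ 0 * u₁ 0) * Real.exp (∫ s in (0 : ℝ)..t, a s) := by
  refine eq_mul_exp_integral_of_hasDerivAt (w := fun t => y₁ t * u₂ t - y₂ t * u₁ t) ha
    (fun t => ?_) t
  refine (((hy₁ t).mul (hu₂ t)).sub ((hy₂ t).mul (hu₁ t))).congr_deriv ?_
  ring


/-- **`t`-dependent superposition rule for dissipative Milne–Pinney equations**: given two
solutions `y₁, y₂` of `ÿ = a(t)ẏ + b(t)y` with initial Wronskian `W₀ ≠ 0`, and `I₁, I₂`
with `4I₁I₂ − kW₀² ≥ 0`, the function `x = (√2/|W₀|)·√Q`, with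
`Q = I₂y₁² + I₁y₂² + √(4I₁I₂ − kW₀²)·y₁y₂`, solves the dissipative Milne–Pinney equation
`ẍ = a(t)ẋ + b(t)x + k·exp(2∫₀ᵗ a(s)ds)/x³` on any open interval where `Q > 0`. -/
theorem dissipative_milne_pinney_superposition_rule
    (a b : ℝ → ℝ) (ha : Continuous a) (hb : Continuous b) (k : ℝ)
    (y₁ y₂ u₁ u₂ : ℝ → ℝ)
    (hy₁ : ∀ t, HasDerivAt y₁ (u₁ t) t)
    (hu₁ : ∀ t, HasDerivAt u₁ (a t * u₁ t + b t * y₁ t) t)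
    (hy₂ : ∀ t, HasDerivAt y₂ (u₂ t) t)
    (hu₂ : ∀ t, HasDerivAt u₂ (a t * u₂ t + b t * y₂ t) t)
    (W₀ : ℝ) (hW₀def : W₀ = y₁ 0 * u₂ 0 - y₂ 0 * u₁ 0) (hW₀ : W₀ ≠ 0)
    (I₁ I₂ : ℝ) (hI : 0 ≤ 4 * I₁ * I₂ - k * W₀ ^ 2)
    (Q : ℝ → ℝ)
    (hQdef : ∀ t, Q t = I₂ * y₁ t ^ 2 + I₁ * y₂ t ^ 2
      + Real.sqrt (4 * I₁ * I₂ - k * W₀ ^ 2) * y₁ t * y₂ t)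
    (J : Set ℝ) (hJ : IsOpen J) (hJ' : J.OrdConnected)
    (hQpos : ∀ t ∈ J, 0 < Q t)
    (x : ℝ → ℝ)
    (hxdef : ∀ t, x t = (Real.sqrt 2 / |W₀|) * Real.sqrt (Q t)) :
    ∃ v : ℝ → ℝ, ∀ t ∈ J,
      HasDerivAt x (v t) t ∧
      HasDerivAt v (a t * v t + b t * x t
        + k * Real.exp (2 * ∫ s in (0 : ℝ)..t, a s) / x t ^ 3) t := by
  set c := Real.sqrt (4 * I₁ * I₂ - k * W₀ ^ 2)
  have hcsq : c ^ 2 = 4 * I₁ * I₂ - k * W₀ ^ 2 := Real.sq_sqrt hI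
  set C := Real.sqrt 2 / |W₀| with hC
  have hCpos : 0 < C := div_pos (by positivity) (abs_pos.mpr hW₀)
  have hCsq : C ^ 2 * W₀ ^ 2 = 2 := by
    rw [hC, div_pow, sq_abs, Real.sq_sqrt zero_le_two, div_mul_cancel₀ _ (pow_ne_zero 2 hW₀)]
  obtain rfl : x = fun t => C * Real.sqrt (Q t) := funext hxdef
  let P : ℝ → ℝ := fun t => 2 * I₂ * y₁ t * u₁ t + 2 * I₁ * y₂ t * u₂ t
    + c * (u₁ t * y₂ t + y₁ t * u₂ t)
  let R : ℝ → ℝ := fun t => I₂ * u₁ t ^ 2 + I₁ * u₂ t ^ 2 + c * u₁ t * u₂ t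
  have hQ (t : ℝ) : HasDerivAt Q (P t) t := by
    rw [funext hQdef]
    refine (((((hy₁ t).pow 2).const_mul I₂).add (((hy₂ t).pow 2).const_mul I₁)).add
      (((hy₁ t).const_mul c).mul (hy₂ t))).congr_deriv ?_
    simp only [P]
    push_cast
    ring
  have hP (t : ℝ) : HasDerivAt P (a t * P t + 2 * b t * Q t + 2 * R t) t := by
    refine (((((hy₁ t).const_mul (2 * I₂)).mul (hu₁ t)).add
      (((hy₂ t).const_mul (2 * I₁)).mul (hu₂ t))).add
      ((((hu₁ t).mul (hy₂ t)).add ((hy₁ t).mul (hu₂ t))).const_mul c)).congr_deriv ?_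
    simp only [P, R, hQdef]
    ring
  have hdisc (t : ℝ) : 4 * R t * Q t - P t ^ 2
      = k * W₀ ^ 4 * Real.exp (2 * ∫ s in (0 : ℝ)..t, a s) := by
    have hW := wronskian_eq_mul_exp_integral ha hy₁ hu₁ hy₂ hu₂ t
    rw [← hW₀def] at hW
    calc 4 * R t * Q t - P t ^ 2
        = (4 * I₁ * I₂ - c ^ 2) * (y₁ t * u₂ t - y₂ t * u₁ t) ^ 2 := by
          simp only [P, R, hQdef]
          ring
      _ = k * W₀ ^ 4 * Real.exp (2 * ∫ s in (0 : ℝ)..t, a s) := by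
          rw [hcsq, hW, two_mul, Real.exp_add]
          ring
  refine ⟨fun t => C * (P t / (2 * Real.sqrt (Q t))), fun t ht => ?_⟩
  have hsqrt := (hQ t).sqrt (hQpos t ht).ne'
  have hs : 0 < Real.sqrt (Q t) := Real.sqrt_pos.mpr (hQpos t ht)
  have hssq : Q t = Real.sqrt (Q t) ^ 2 := (Real.sq_sqrt (hQpos t ht).le).symm
  refine ⟨hsqrt.const_mul C, ?_⟩
  refine (((hP t).div (hsqrt.const_mul 2) (by positivity)).const_mul C).congr_deriv ?_
  have hE : k * Real.exp (2 * ∫ s in (0 : ℝ)..t, a s)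
      = C ^ 4 / 4 * (4 * R t * Q t - P t ^ 2) := by
    rw [hdisc]
    linear_combination (-(k * Real.exp (2 * ∫ s in (0 : ℝ)..t, a s)) / 4
      * (C ^ 2 * W₀ ^ 2 + 2)) * hCsq
  beta_reduce
  rw [hE]
  generalize Real.sqrt (Q t) = s at hs hssq ⊢
  rw [hssq]
  field_simp
  ring
end

section
/- (t-dependent constant of the motion for Emden–Fowler equations) Let a : ℝ → ℝ, let n ∈ ℤ with n ≠ 1 and n ≠ −1, and let J be an open interval. Suppose x_p : J → ℝ is a twice-differentiable particular solution of the Emden equation ẍ(t) = a(t)ẋ(t) − x(t)ⁿ with x_p(t) ≠ 0 and ẋ_p(t) ≠ 0 for all t ∈ J, satisfying the condition ẋ_p(t)² = x_p(t)^{n+1} for all t ∈ J. Then for every twice-differentiable nowhere-vanishing solution x : J → ℝ of the same equation ẍ = a(t)ẋ − xⁿ, the function t ↦ x(t)^{n+1}/((n+1)·x_p(t)^{n+1}) + ẋ(t)²/(2·ẋ_p(t)²) − x(t)ẋ(t)/(x_p(t)ẋ_p(t)) is constant on J. -/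
/-- **`t`-dependent constant of the motion for Emden–Fowler equations**: if `x_p` is a
particular solution of `ẍ = a(t)ẋ − xⁿ` on an open interval `J` with `x_p ≠ 0`, `ẋ_p ≠ 0`
and `ẋ_p² = x_p^{n+1}` on `J`, then for every nowhere-vanishing solution `x` of the same
equation the function
`x^{n+1}/((n+1)x_p^{n+1}) + ẋ²/(2ẋ_p²) − xẋ/(x_pẋ_p)` is constant on `J`. -/
theorem emden_t_dependent_invariant
    (a : ℝ → ℝ) (n : ℤ) (hn1 : n ≠ 1) (hn2 : n ≠ -1)
    (J : Set ℝ) (hJ : IsOpen J) (hJ' : J.OrdConnected)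
    (xp vp : ℝ → ℝ)
    (hxp0 : ∀ t ∈ J, xp t ≠ 0) (hvp0 : ∀ t ∈ J, vp t ≠ 0)
    (hxp : ∀ t ∈ J, HasDerivAt xp (vp t) t)
    (hvp : ∀ t ∈ J, HasDerivAt vp (a t * vp t - xp t ^ n) t)
    (hcond : ∀ t ∈ J, vp t ^ 2 = xp t ^ (n + 1))
    (x v : ℝ → ℝ) (hx0 : ∀ t ∈ J, x t ≠ 0)
    (hx : ∀ t ∈ J, HasDerivAt x (v t) t)
    (hv : ∀ t ∈ J, HasDerivAt v (a t * v t - x t ^ n) t) :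
    ∃ c : ℝ, ∀ t ∈ J,
      x t ^ (n + 1) / (((n : ℝ) + 1) * xp t ^ (n + 1))
        + v t ^ 2 / (2 * vp t ^ 2)
        - x t * v t / (xp t * vp t) = c := by
  have hn : (n : ℝ) + 1 ≠ 0 := by
    exact_mod_cast fun h : n + 1 = 0 => hn2 (by omega)
  have hq (t : ℝ) (ht : t ∈ J) :
      a t * vp t - xp t ^ n = ((n : ℝ) + 1) / 2 * xp t ^ n := by
    have h₁ := (hvp t ht).pow 2
    have h₂ := (hasDerivAt_zpow (n + 1) (xp t) (Or.inl (hxp0 t ht))).comp t (hxp t ht)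
    have heq : (fun s => xp s ^ (n + 1)) =ᶠ[nhds t] vp ^ 2 := by
      filter_upwards [hJ.mem_nhds ht] with s hs
      exact (hcond s hs).symm
    have h := h₁.unique (h₂.congr_of_eventuallyEq heq.symm)
    rw [add_sub_cancel_right] at h
    push_cast at h
    apply mul_right_cancel₀ (hvp0 t ht)
    linear_combination h / 2
  let F : ℝ → ℝ := fun t => x t ^ (n + 1) / (((n : ℝ) + 1) * vp t ^ 2)
    + v t ^ 2 / (2 * vp t ^ 2) - x t * v t / (xp t * vp t)
  have hF (t : ℝ) (ht : t ∈ J) : HasDerivAt F 0 t := by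
    have hp := hxp0 t ht
    have hv0 := hvp0 t ht
    have hzpow : HasDerivAt (fun s => x s ^ (n + 1)) (((n : ℝ) + 1) * x t ^ n * v t) t := by
      have h := (hasDerivAt_zpow (n + 1) (x t) (Or.inl (hx0 t ht))).comp t (hx t ht)
      rw [add_sub_cancel_right] at h
      push_cast at h
      exact h
    have hsq := (hvp t ht).fun_pow 2
    have h := ((hzpow.fun_div (hsq.const_mul ((n : ℝ) + 1))
        (mul_ne_zero hn (pow_ne_zero 2 hv0))).fun_add
      (((hv t ht).fun_pow 2).fun_div (hsq.const_mul 2)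
        (mul_ne_zero two_ne_zero (pow_ne_zero 2 hv0)))).fun_sub
      (((hx t ht).fun_mul (hv t ht)).fun_div ((hxp t ht).fun_mul (hvp t ht))
        (mul_ne_zero hp hv0))
    refine h.congr_deriv ?_
    have hE : xp t ^ n = vp t ^ 2 / xp t := by
      rw [hcond t ht, zpow_add_one₀ hp, mul_div_cancel_right₀ _ hp]
    have ha : a t = ((n : ℝ) + 3) / 2 * vp t / xp t := by
      have h := hq t ht
      rw [hE] at h
      field_simp at h ⊢
      linear_combination h
    rw [hq t ht, hE, ha, zpow_add_one₀ (hx0 t ht)]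
    generalize x t ^ n = X
    field_simp
    ring
  obtain ⟨c, hc⟩ := hJ.exists_is_const_of_deriv_eq_zero hJ'.isPreconnected
    (fun t ht => (hF t ht).differentiableAt.differentiableWithinAt)
    (fun t ht => (hF t ht).deriv)
  refine ⟨c, fun t ht => ?_⟩
  rw [← hcond t ht]
  exact hc t ht
end
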